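/- arXiv:2408.12876 — 2 statements merged into one kernel-verified Lean document; each statement's English description precedes it below -/
import Mathlib

section
/- Let β ∈ ℂ with Re β > 0 and let μ ∈ ℕ*. Then there exists a constant C > 0 such that for every u ∈ ℂ, Re(β·u^{2μ}) ≥ (Re β)/2 · (Re u)^{2μ} − C · (Im u)^{2μ}. -/
open Complex

/-- Let `β ∈ ℂ` with `Re β > 0` and `μ ≥ 1`. There is `C > 0` such that for every `u ∈ ℂ`,
`Re (β u^{2μ}) ≥ (Re β)/2 (Re u)^{2μ} - C (Im u)^{2μ}`. -/
theorem re_beta_pow_lower_bound (β : ℂ) (hβ : 0 < β.re) (μ : ℕ) (hμ : 1 ≤ μ) :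
    ∃ C : ℝ, 0 < C ∧ ∀ u : ℂ,
      (β * u ^ (2 * μ)).re ≥ β.re / 2 * u.re ^ (2 * μ) - C * u.im ^ (2 * μ) := by
  have hev : Even (2 * μ) := even_two_mul μ
  have hc : Continuous (fun t : ℝ => (β * (1 + (t : ℂ) * I) ^ (2 * μ)).re) := by fun_prop
  have h0 : ∀ᶠ t : ℝ in nhds (0 : ℝ), β.re / 2 < (β * (1 + (t : ℂ) * I) ^ (2 * μ)).re := by
    apply hc.continuousAt.eventually_const_lt
    simp
    linarith
  obtain ⟨δ, hδ, h⟩ := Metric.eventually_nhds_iff.1 h0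
  have hK : 0 < 1 / δ + 1 := by positivity
  refine ⟨(‖β‖ + β.re / 2) * (1 / δ + 1) ^ (2 * μ), by positivity, fun u => ?_⟩
  have hy : 0 ≤ u.im ^ (2 * μ) := hev.pow_nonneg _
  by_cases hu : |u.im| < δ * |u.re|
  · have hx : u.re ≠ 0 := by
      intro hx
      rw [hx] at hu
      simp at hu
      linarith [abs_nonneg u.im]
    have ht := h (y := u.im / u.re) (by
      rw [Real.dist_eq, sub_zero, abs_div, div_lt_iff₀ (abs_pos.2 hx)]
      exact hu)
    have e : u = (u.re : ℂ) * (1 + ((u.im / u.re : ℝ) : ℂ) * I) := by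
      have hx' : (u.re : ℂ) ≠ 0 := by exact_mod_cast hx
      conv_lhs => rw [← re_add_im u]
      push_cast
      field_simp
    have e2 : (β * u ^ (2 * μ)).re
        = u.re ^ (2 * μ) * (β * (1 + ((u.im / u.re : ℝ) : ℂ) * I) ^ (2 * μ)).re := by
      rw [← re_ofReal_mul]
      congr 1
      conv_lhs => rw [e]
      rw [mul_pow]
      push_cast
      ring
    rw [e2]
    have hxn : 0 ≤ u.re ^ (2 * μ) := hev.pow_nonneg _
    have h1 := mul_le_mul_of_nonneg_left ht.le hxn
    have h2 : 0 ≤ (‖β‖ + β.re / 2) * (1 / δ + 1) ^ (2 * μ) * u.im ^ (2 * μ) := by positivity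
    linarith
  · push Not at hu
    have hx : |u.re| ≤ 1 / δ * |u.im| := by
      rw [one_div, inv_mul_eq_div, le_div_iff₀ hδ]
      linarith
    have hn : ‖u‖ ≤ (1 / δ + 1) * |u.im| := by
      have := norm_le_abs_re_add_abs_im u
      linarith
    have hp : ‖u‖ ^ (2 * μ) ≤ (1 / δ + 1) ^ (2 * μ) * u.im ^ (2 * μ) := by
      rw [← hev.pow_abs u.im, ← mul_pow]
      exact pow_le_pow_left₀ (norm_nonneg _) hn _
    have hxp : u.re ^ (2 * μ) ≤ ‖u‖ ^ (2 * μ) := by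
      rw [← hev.pow_abs u.re]
      exact pow_le_pow_left₀ (abs_nonneg _) (abs_re_le_norm u) _
    have hr : -(‖β‖ * ‖u‖ ^ (2 * μ)) ≤ (β * u ^ (2 * μ)).re := by
      have := (abs_le.1 (abs_re_le_norm (β * u ^ (2 * μ)))).1
      rwa [norm_mul, norm_pow] at this
    have h1 := mul_le_mul_of_nonneg_left hp (norm_nonneg β)
    have h2 := mul_le_mul_of_nonneg_left (hxp.trans hp) (half_pos hβ).le
    linarith
end

section
/- Let λ ∈ ℝ and let a = (a_ℓ)_{ℓ∈ℤ} be the finitely supported sequence with a_{−1} = λ(2−λ)(λ−1)/6, a₀ = (2−λ)(1−λ²)/2, a₁ = λ(2−λ)(1+λ)/2, a₂ = −λ(1−λ²)/6, and a_ℓ = 0 otherwise. Then, as the complex number ξ tends to 0, e^{−iλξ} F_a(e^{iξ}) = 1 − (λ(2−λ)(1−λ²)/24) ξ⁴ − i (λ(2−λ)(1−λ²)(1−2λ)/60) ξ⁵ + (λ(2−λ)(1−λ²)(1−2λ+2λ²)/144) ξ⁶ + i (λ(2−λ)(1−λ²)(1−2λ)(1−λ+λ²)/504) ξ⁷ + O(ξ⁸).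 -/
open Complex Asymptotics

/-- The amplification factor sequence of the O3 scheme with Courant parameter `λ`. -/
noncomputable def O3seq (lam : ℝ) : ℤ → ℂ := fun ℓ =>
  if ℓ = -1 then (lam * (2 - lam) * (lam - 1) / 6 : ℝ)
  else if ℓ = 0 then ((2 - lam) * (1 - lam ^ 2) / 2 : ℝ)
  else if ℓ = 1 then (lam * (2 - lam) * (1 + lam) / 2 : ℝ)
  else if ℓ = 2 then (-(lam * (1 - lam ^ 2)) / 6 : ℝ)
  else 0

theorem O3_aux (c : ℂ) :
    (fun ξ : ℂ => Complex.exp (Complex.I * c * ξ) -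
      (1 + Complex.I * (c * ξ) - (c * ξ) ^ 2 / 2 - Complex.I * (c * ξ) ^ 3 / 6 + (c * ξ) ^ 4 / 24
        + Complex.I * (c * ξ) ^ 5 / 120 - (c * ξ) ^ 6 / 720 - Complex.I * (c * ξ) ^ 7 / 5040))
      =O[nhds 0] fun ξ : ℂ => ξ ^ 8 := by
  have h := Complex.exp_sub_sum_range_isBigO_pow 8
  have ht : Filter.Tendsto (fun ξ : ℂ => Complex.I * c * ξ) (nhds 0) (nhds 0) := by
    have : Continuous (fun ξ : ℂ => Complex.I * c * ξ) := by fun_prop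
    simpa using this.tendsto 0
  have h2 := h.comp_tendsto ht
  have h3 : ((fun x : ℂ => x ^ 8) ∘ fun ξ : ℂ => Complex.I * c * ξ) =O[nhds 0]
      fun ξ : ℂ => ξ ^ 8 := by
    have : ((fun x : ℂ => x ^ 8) ∘ fun ξ : ℂ => Complex.I * c * ξ)
        = fun ξ => (Complex.I * c) ^ 8 * ξ ^ 8 := by
      funext ξ; simp only [Function.comp]; ring
    rw [this]
    exact (isBigO_refl _ _).const_mul_left _
  refine (h2.trans h3).congr_left fun ξ => ?_
  have e2 : Complex.I ^ 2 = -1 := Complex.I_sq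
  have e3 : Complex.I ^ 3 = -Complex.I := Complex.I_pow_three
  have e4 : Complex.I ^ 4 = 1 := Complex.I_pow_four
  have e5 : Complex.I ^ 5 = Complex.I := by rw [pow_succ, e4, one_mul]
  have e6 : Complex.I ^ 6 = -1 := by rw [pow_succ, e5, ← sq, e2]
  have e7 : Complex.I ^ 7 = -Complex.I := by rw [pow_succ, e6]; ring
  simp only [Function.comp, Finset.sum_range_succ, Finset.sum_range_zero, Nat.factorial, mul_pow,
    e2, e3, e4, e5, e6, e7]
  push_cast
  ring

theorem O3_tsum (lam : ℝ) (z : ℂ) :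
    (∑' ℓ : ℤ, O3seq lam ℓ * z ^ ℓ) =
      (lam * (2 - lam) * (lam - 1) / 6 : ℝ) * z ^ (-1 : ℤ) + ((2 - lam) * (1 - lam ^ 2) / 2 : ℝ)
      + (lam * (2 - lam) * (1 + lam) / 2 : ℝ) * z + (-(lam * (1 - lam ^ 2)) / 6 : ℝ) * z ^ (2 : ℤ) := by
  rw [tsum_eq_sum (s := ({-1, 0, 1, 2} : Finset ℤ))]
  · rw [Finset.sum_insert (by decide), Finset.sum_insert (by decide),
      Finset.sum_insert (by decide), Finset.sum_singleton]
    have h1 : O3seq lam (-1) = (lam * (2 - lam) * (lam - 1) / 6 : ℝ) := by simp [O3seq]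
    have h2 : O3seq lam 0 = ((2 - lam) * (1 - lam ^ 2) / 2 : ℝ) := by simp [O3seq]
    have h3 : O3seq lam 1 = (lam * (2 - lam) * (1 + lam) / 2 : ℝ) := by simp [O3seq]
    have h4 : O3seq lam 2 = (-(lam * (1 - lam ^ 2)) / 6 : ℝ) := by simp [O3seq]
    rw [h1, h2, h3, h4, zpow_zero, zpow_one]
    ring
  · intro b hb
    simp only [Finset.mem_insert, Finset.mem_singleton, not_or] at hb
    simp [O3seq, hb.1, hb.2.1, hb.2.2.1, hb.2.2.2]

/-- Expansion of `e^{-iλξ} F_a (e^{iξ})` at `ξ = 0` for the O3 scheme, up to `O(ξ⁸)`. -/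
theorem O3_expansion (lam : ℝ) :
    (fun ξ : ℂ =>
        Complex.exp (-Complex.I * lam * ξ) *
          (∑' ℓ : ℤ, O3seq lam ℓ * Complex.exp (Complex.I * ξ) ^ ℓ) -
        (1 - (lam * (2 - lam) * (1 - lam ^ 2) / 24 : ℝ) * ξ ^ 4
           - Complex.I * (lam * (2 - lam) * (1 - lam ^ 2) * (1 - 2 * lam) / 60 : ℝ) * ξ ^ 5
           + (lam * (2 - lam) * (1 - lam ^ 2) * (1 - 2 * lam + 2 * lam ^ 2) / 144 : ℝ) * ξ ^ 6
           + Complex.I * (lam * (2 - lam) * (1 - lam ^ 2) * (1 - 2 * lam) *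
               (1 - lam + lam ^ 2) / 504 : ℝ) * ξ ^ 7)) =O[nhds 0]
      fun ξ : ℂ => ξ ^ 8 := by
  have H := ((((O3_aux (-1 - lam)).const_mul_left ((lam * (2 - lam) * (lam - 1) / 6 : ℝ) : ℂ)).add
    ((O3_aux (0 - lam)).const_mul_left (((2 - lam) * (1 - lam ^ 2) / 2 : ℝ) : ℂ))).add
    ((O3_aux (1 - lam)).const_mul_left ((lam * (2 - lam) * (1 + lam) / 2 : ℝ) : ℂ))).add
    ((O3_aux (2 - lam)).const_mul_left ((-(lam * (1 - lam ^ 2)) / 6 : ℝ) : ℂ))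
  refine H.congr_left fun ξ => ?_
  have E (n : ℤ) : Complex.exp (Complex.I * (n - lam) * ξ)
      = Complex.exp (-Complex.I * lam * ξ) * Complex.exp (Complex.I * ξ) ^ n := by
    rw [← Complex.exp_int_mul, ← Complex.exp_add]; congr 1; ring
  have E1 := E (-1)
  have E2 := E 0
  have E3 := E 1
  have E4 := E 2
  push_cast at E1 E2 E3 E4
  rw [zpow_zero] at E2
  rw [zpow_one] at E3
  rw [O3_tsum, E1, E2, E3, E4]
  generalize Complex.exp (Complex.I * ξ) ^ (-1 : ℤ) = u
  generalize Complex.exp (Complex.I * ξ) ^ (2 : ℤ) = v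
  generalize Complex.exp (Complex.I * ξ) = w
  generalize Complex.exp (-Complex.I * lam * ξ) = p
  push_cast
  ring
end
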